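/- arXiv:math/9903166 — 2 statements merged into one kernel-verified Lean document; each statement's English description precedes it below -/
import Mathlib

section
/- Suppose a Kakeya estimate holds at dimension d ∈ (2,3) with exponent α ∈ (0,1) and constant A₀. Then there is a constant A (depending only on d, α, A₀) such that for all 0 < δ ≤ σ ≤ θ ≤ c₀ (c₀ a small absolute constant) and every collection 𝕋_σ of essentially distinct σ-tubes, with directional multiplicity at most m₀ at scale σ, whose directions all lie in a cap of radius θ, one has ‖Σ_{T_σ∈𝕋_σ} χ_{T_σ}‖_{L^{d'}(ℝ³)} ≤ A · m₀ · σ^{(d−3)/d} · θ^{(d+1)/d}, where d' = d/(d−1). (The case m₀ = O(1) is the case of a direction-separated collection.) -/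
open MeasureTheory Metric Set
open scoped ENNReal NNReal RealInnerProductSpace

noncomputable section

abbrev R3 : Type := EuclideanSpace ℝ (Fin 3)

/-- A tube core: a line segment joining the planes {z = 0} and {z = 1},
with orientation within 1/10 of the vertical. -/
structure Tube where
  p0 : R3
  p1 : R3
  h0 : p0 2 = 0
  h1 : p1 2 = 1
  hx : |(p1 - p0) 0| ≤ 1/10
  hy : |(p1 - p0) 1| ≤ 1/10

/-- The direction of a tube: the difference of its endpoints. -/
def Tube.dir (T : Tube) : R3 := T.p1 - T.p0

/-- The σ-tube associated to a tube core: the σ-neighbourhood of the segment. -/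
def Tube.set (T : Tube) (σ : ℝ) : Set R3 :=
  Metric.thickening σ (segment ℝ T.p0 T.p1)

/-- A direction: a vector (x, y, 1) within 1/10 of the vertical. -/
def IsDirection (v : R3) : Prop := v 2 = 1 ∧ |v 0| ≤ 1/10 ∧ |v 1| ≤ 1/10

/-- Two σ-tubes are equivalent (with constant C): each lies in the C-dilate of the other. -/
def TubeEquiv (C σ : ℝ) (T T' : Tube) : Prop :=
  T.set σ ⊆ T'.set (C * σ) ∧ T'.set σ ⊆ T.set (C * σ)

/-- A collection of σ-tubes is essentially distinct (with constant C): each of its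
tubes is equivalent to at most C of the others. -/
def EssDistinct (C σ : ℝ) (𝕋 : Set Tube) : Prop :=
  𝕋.Finite ∧ ∀ T ∈ 𝕋, (({T' ∈ 𝕋 | T' ≠ T ∧ TubeEquiv C σ T T'}.ncard : ℝ)) ≤ C

/-- A δ-separated set. -/
def Separated (δ : ℝ) (E : Set R3) : Prop :=
  ∀ x ∈ E, ∀ y ∈ E, x ≠ y → δ ≤ dist x y

/-- The directional multiplicity of 𝕋 at scale σ is at most m: at most m of the
tubes have directions in any cap of radius σ. -/
def DirMultLE (σ : ℝ) (𝕋 : Set Tube) (m : ℝ) : Prop :=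
  ∀ ω : R3, (({T ∈ 𝕋 | dist T.dir ω ≤ σ}.ncard : ℝ)) ≤ m

/-- The multiplicity function ∑_{T ∈ 𝕋} χ_T of a collection of σ-tubes. -/
def tubeCount (σ : ℝ) (𝕋 : Set Tube) (x : R3) : ℝ :=
  (({T ∈ 𝕋 | x ∈ T.set σ}).ncard : ℝ)

/-- The L^p norm ‖∑_{T ∈ 𝕋} χ_T‖_{L^p(ℝ³)}. -/
def tubeNorm (σ p : ℝ) (𝕋 : Set Tube) : ℝ≥0∞ :=
  (∫⁻ x : R3, ENNReal.ofReal (tubeCount σ 𝕋 x ^ p)) ^ (1 / p)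

/-- An X-ray estimate at dimension d with exponents α, β and constant A₀:
for every 0 < δ < 1, every δ-separated set of directions 𝓔 and every collection 𝕋 of
essentially distinct δ-tubes pointing in directions in 𝓔,
‖∑_{T∈𝕋} χ_T‖_{d'} ≤ A₀ δ^{1-3/d} m^{1-β} (δ² #𝓔)^α where m bounds the directional
multiplicity of 𝕋 and d' = d/(d-1). -/
def XRayEstimate (Ceq d α β A₀ : ℝ) : Prop :=
  ∀ δ : ℝ, 0 < δ → δ < 1 →
    ∀ 𝓔 : Set R3, (∀ v ∈ 𝓔, IsDirection v) → Separated δ 𝓔 → 𝓔.Finite →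
      ∀ 𝕋 : Set Tube, EssDistinct Ceq δ 𝕋 → (∀ T ∈ 𝕋, T.dir ∈ 𝓔) →
        ∀ m : ℝ, DirMultLE δ 𝕋 m →
          tubeNorm δ (d / (d - 1)) 𝕋 ≤
            ENNReal.ofReal (A₀ * δ ^ (1 - 3 / d) * m ^ (1 - β) * (δ ^ 2 * 𝓔.ncard) ^ α)

/-- A Kakeya estimate at dimension d with exponent α and constant A₀ (the β = 0
case of the X-ray estimate). -/
def KakeyaEstimate (Ceq d α A₀ : ℝ) : Prop :=
  ∀ δ : ℝ, 0 < δ → δ < 1 →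
    ∀ 𝓔 : Set R3, (∀ v ∈ 𝓔, IsDirection v) → Separated δ 𝓔 → 𝓔.Finite →
      ∀ 𝕋 : Set Tube, EssDistinct Ceq δ 𝕋 → (∀ T ∈ 𝕋, T.dir ∈ 𝓔) →
        ∀ m : ℝ, DirMultLE δ 𝕋 m →
          tubeNorm δ (d / (d - 1)) 𝕋 ≤
            ENNReal.ofReal (A₀ * δ ^ (1 - 3 / d) * m * (δ ^ 2 * 𝓔.ncard) ^ α)

section TubeLemmas

lemma abs_apply_le_norm (x : R3) (i : Fin 3) : |x i| ≤ ‖x‖ := by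
  simpa using PiLp.norm_apply_le x i

lemma sq_norm_R3 (x : R3) : ‖x‖ ^ 2 = x 0 ^ 2 + x 1 ^ 2 + x 2 ^ 2 := by
  rw [EuclideanSpace.real_norm_sq_eq, Fin.sum_univ_three]

lemma norm_le_of_sq_le {x : R3} {r : ℝ} (hr : 0 ≤ r)
    (h : x 0 ^ 2 + x 1 ^ 2 + x 2 ^ 2 ≤ r ^ 2) : ‖x‖ ≤ r := by
  rw [← sq_norm_R3] at h
  exact le_of_sq_le_sq h hr

lemma Tube.isDirection_dir (T : Tube) : IsDirection T.dir :=
  ⟨by simp [Tube.dir, T.h0, T.h1], T.hx, T.hy⟩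

lemma IsDirection.norm_le {v : R3} (hv : IsDirection v) : ‖v‖ ≤ 2 := by
  obtain ⟨h2, h0, h1⟩ := hv
  refine norm_le_of_sq_le (by norm_num) ?_
  rw [h2]
  have := sq_le_sq' (abs_le.1 h0).1 (abs_le.1 h0).2
  have := sq_le_sq' (abs_le.1 h1).1 (abs_le.1 h1).2
  linarith

lemma Tube.mem_set_iff (T : Tube) (σ : ℝ) (x : R3) :
    x ∈ T.set σ ↔ ∃ t ∈ Icc (0 : ℝ) 1, dist x (T.p0 + t • T.dir) < σ := by
  rw [Tube.set, Metric.mem_thickening_iff, segment_eq_image']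
  simp [Tube.dir]

lemma measurable_tubeCount (σ : ℝ) {𝕋 : Set Tube} (h𝕋 : 𝕋.Finite) :
    Measurable (tubeCount σ 𝕋) := by
  classical
  have : tubeCount σ 𝕋 = fun x ↦ ∑ T ∈ h𝕋.toFinset, (T.set σ).indicator (fun _ ↦ (1 : ℝ)) x := by
    ext x
    have h : {T ∈ 𝕋 | x ∈ T.set σ} = ↑(h𝕋.toFinset.filter fun T ↦ x ∈ T.set σ) := by
      ext; simp
    rw [tubeCount, h, Set.ncard_coe_finset, Finset.card_filter]
    simp [Set.indicator_apply]
  rw [this]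
  exact Finset.measurable_sum _ fun T _ ↦
    measurable_const.indicator Metric.isOpen_thickening.measurableSet

lemma tubeCount_nonneg (σ : ℝ) (𝕋 : Set Tube) (x : R3) : 0 ≤ tubeCount σ 𝕋 x :=
  Nat.cast_nonneg _

lemma tubeNorm_empty (σ : ℝ) {p : ℝ} (hp : 0 < p) : tubeNorm σ p ∅ = 0 := by
  simp [tubeNorm, tubeCount, hp, hp.ne']

lemma tubeCount_le_sum {ι : Type*} [DecidableEq ι] (σ : ℝ) {𝕋 : Set Tube} (h𝕋 : 𝕋.Finite)
    (s : Finset ι) (col : Tube → ι) (hcol : ∀ T ∈ 𝕋, col T ∈ s) (x : R3) :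
    tubeCount σ 𝕋 x ≤ ∑ c ∈ s, tubeCount σ {T ∈ 𝕋 | col T = c} x := by
  classical
  have h : ∀ P : Tube → Prop, {T ∈ 𝕋 | P T}.ncard = (h𝕋.toFinset.filter P).card := fun P ↦ by
    rw [← Set.ncard_coe_finset]; congr 1; ext; simp
  have h' : ∀ c, tubeCount σ {T ∈ 𝕋 | col T = c} x =
      (((h𝕋.toFinset.filter fun T ↦ x ∈ T.set σ).filter fun T ↦ col T = c).card : ℝ) := fun c ↦ by
    rw [tubeCount, ← Set.ncard_coe_finset]
    congr 2; ext; simp; tauto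
  simp only [h']
  rw [tubeCount, h, ← Nat.cast_sum, ← Finset.card_eq_sum_card_fiberwise]
  intro T hT
  exact hcol T (by simp at hT; exact hT.1)

/-- A collection of tubes split into `#s` subcollections obeys `#s` times a common bound. -/
lemma tubeNorm_le_card_mul {ι : Type*} [DecidableEq ι] (σ : ℝ) {p : ℝ} (hp : 1 ≤ p)
    {𝕋 : Set Tube} (h𝕋 : 𝕋.Finite) (s : Finset ι) (col : Tube → ι)
    (hcol : ∀ T ∈ 𝕋, col T ∈ s) {B : ℝ≥0∞}
    (hB : ∀ c ∈ s, tubeNorm σ p {T ∈ 𝕋 | col T = c} ≤ B) :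
    tubeNorm σ p 𝕋 ≤ s.card * B := by
  have hp0 : 0 < p := by linarith
  set f : ι → R3 → ℝ≥0∞ := fun c x ↦ ENNReal.ofReal (tubeCount σ {T ∈ 𝕋 | col T = c} x ^ p)
  have hfm : ∀ c, Measurable (f c) := fun c ↦
    ((measurable_tubeCount σ (h𝕋.subset (Set.sep_subset _ _))).pow_const p).ennreal_ofReal
  have hf : ∀ c ∈ s, ∫⁻ x, f c x ≤ B ^ p := fun c hc ↦ by
    have := ENNReal.rpow_le_rpow (hB c hc) hp0.le
    rwa [tubeNorm, ← ENNReal.rpow_mul, one_div_mul_cancel hp0.ne', ENNReal.rpow_one] at this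
  have hpt : ∀ x, ENNReal.ofReal (tubeCount σ 𝕋 x ^ p) ≤
      (s.card : ℝ≥0∞) ^ (p - 1) * ∑ c ∈ s, f c x := fun x ↦ by
    rw [← ENNReal.ofReal_rpow_of_nonneg (tubeCount_nonneg _ _ _) hp0.le]
    have h1 : ENNReal.ofReal (tubeCount σ 𝕋 x) ≤
        ∑ c ∈ s, ENNReal.ofReal (tubeCount σ {T ∈ 𝕋 | col T = c} x) := by
      rw [← ENNReal.ofReal_sum_of_nonneg fun c _ ↦ tubeCount_nonneg _ _ _]
      exact ENNReal.ofReal_le_ofReal (tubeCount_le_sum σ h𝕋 s col hcol x)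
    refine (ENNReal.rpow_le_rpow h1 hp0.le).trans ?_
    refine (ENNReal.rpow_sum_le_const_mul_sum_rpow _ _ hp).trans_eq ?_
    congr 1
    exact Finset.sum_congr rfl fun c _ ↦
      ENNReal.ofReal_rpow_of_nonneg (tubeCount_nonneg _ _ _) hp0.le
  have hint : ∫⁻ x : R3, ENNReal.ofReal (tubeCount σ 𝕋 x ^ p) ≤ (s.card * B) ^ p := by
    refine (lintegral_mono hpt).trans ?_
    rw [lintegral_const_mul _ (Finset.measurable_sum _ fun c _ ↦ hfm c),
      lintegral_finsetSum _ fun c _ ↦ hfm c]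
    refine (mul_le_mul_right (Finset.sum_le_card_nsmul s _ _ hf) _).trans_eq ?_
    rw [nsmul_eq_mul, ← mul_assoc, ENNReal.mul_rpow_of_nonneg _ _ hp0.le]
    congr 1
    rcases Nat.eq_zero_or_pos s.card with h | h
    · simp [h, hp0]
    · nth_rw 2 [← ENNReal.rpow_one (s.card : ℝ≥0∞)]
      rw [← ENNReal.rpow_add _ _ (by simpa using h.ne') (by simp)]
      simp
  calc tubeNorm σ p 𝕋 ≤ ((s.card * B) ^ p) ^ (1 / p) := ENNReal.rpow_le_rpow hint (by positivity)
    _ = s.card * B := by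
      rw [← ENNReal.rpow_mul, mul_one_div_cancel hp0.ne', ENNReal.rpow_one]

lemma abs_sub_lt_of_floor_eq {x y c : ℝ} (hc : 0 < c) (h : ⌊x / c⌋ = ⌊y / c⌋) : |x - y| < c := by
  have := Int.abs_sub_lt_one_of_floor_eq_floor h
  rwa [← sub_div, abs_div, abs_of_pos hc, div_lt_one hc] at this

lemma lt_abs_sub_of_floor_ne {x y c : ℝ} (hc : 0 < c) {M : ℕ}
    (hM : (⌊x / c⌋ : ZMod M) = ⌊y / c⌋) (h : ⌊x / c⌋ ≠ ⌊y / c⌋) :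
    (M - 1) * c < |x - y| := by
  rw [ZMod.intCast_eq_intCast_iff_dvd_sub] at hM
  have h1 : (M : ℤ) ≤ |⌊y / c⌋ - ⌊x / c⌋| :=
    Int.le_of_dvd (abs_pos.2 (sub_ne_zero.2 h.symm)) ((dvd_abs _ _).2 hM)
  have h1' : (M : ℝ) ≤ |(⌊y / c⌋ : ℝ) - ⌊x / c⌋| := by exact_mod_cast h1
  have hx := Int.floor_le (x / c)
  have hx' := Int.lt_floor_add_one (x / c)
  have hy := Int.floor_le (y / c)
  have hy' := Int.lt_floor_add_one (y / c)
  have h2 : (M : ℝ) - 1 < |x / c - y / c| := by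
    rcases le_abs.1 h1' with h | h
    · rw [lt_abs]; right; linarith
    · rw [lt_abs]; left; linarith
  rwa [← sub_div, abs_div, abs_of_pos hc, lt_div_iff₀ hc] at h2

lemma IsDirection.dist_lt_of_floor_eq {v w : R3} (hv : IsDirection v) (hw : IsDirection w)
    {δ : ℝ} (hδ : 0 < δ) (h0 : ⌊v 0 / (δ / 2)⌋ = ⌊w 0 / (δ / 2)⌋)
    (h1 : ⌊v 1 / (δ / 2)⌋ = ⌊w 1 / (δ / 2)⌋) : dist v w < δ := by
  have e0 := abs_lt.1 (abs_sub_lt_of_floor_eq (by positivity) h0)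
  have e1 := abs_lt.1 (abs_sub_lt_of_floor_eq (by positivity) h1)
  have f0 := sq_lt_sq' e0.1 e0.2
  have f1 := sq_lt_sq' e1.1 e1.2
  rw [dist_eq_norm]
  refine lt_of_pow_lt_pow_left₀ 2 hδ.le ?_
  rw [sq_norm_R3]
  simp only [PiLp.sub_apply, hv.1, hw.1]
  nlinarith [sq_pos_of_pos hδ]

/-- A `δ`-separated set of directions has `O(δ⁻²)` elements. -/
lemma Separated.sq_mul_ncard_le {δ : ℝ} (hδ : 0 < δ) (hδ1 : δ < 1) {E : Set R3}
    (hE : ∀ v ∈ E, IsDirection v) (hs : Separated δ E) : δ ^ 2 * E.ncard ≤ 16 := by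
  set n : ℤ := ⌈1 / 5 / δ⌉
  set F : Finset (ℤ × ℤ) := Finset.Icc (-n) n ×ˢ Finset.Icc (-n) n
  have hn0 : 0 ≤ n := Int.ceil_nonneg (by positivity)
  have hn1 : (n : ℝ) < 1 / 5 / δ + 1 := Int.ceil_lt_add_one _
  have hmem : ∀ x : ℝ, |x| ≤ 1 / 10 → ⌊x / (δ / 2)⌋ ∈ Finset.Icc (-n) n := by
    intro x hx
    have e : 1 / 5 / δ ≤ n := Int.le_ceil _
    have hx' : |x / (δ / 2)| ≤ 1 / 5 / δ := by
      rw [abs_div, abs_of_pos (half_pos hδ), div_le_div_iff₀ (half_pos hδ) hδ]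
      nlinarith
    rw [abs_le] at hx'
    rw [Finset.mem_Icc]
    constructor
    · rw [Int.le_floor]; push_cast; linarith
    · exact Int.floor_le_iff.2 (by linarith)
  have hcard : E.ncard ≤ F.card := by
    rw [← Set.ncard_coe_finset F]
    refine Set.ncard_le_ncard_of_injOn (fun v ↦ (⌊v 0 / (δ / 2)⌋, ⌊v 1 / (δ / 2)⌋)) ?_ ?_
      (Finset.finite_toSet _)
    · intro v hv
      exact Finset.mem_product.2 ⟨hmem _ (hE v hv).2.1, hmem _ (hE v hv).2.2⟩
    · intro v hv w hw h
      by_contra hne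
      simp only [Prod.mk.injEq] at h
      exact absurd (hs v hv w hw hne)
        (not_le.2 ((hE v hv).dist_lt_of_floor_eq (hE w hw) hδ h.1 h.2))
  have hF : (F.card : ℝ) = (2 * n + 1) ^ 2 := by
    have : (F.card : ℤ) = (2 * n + 1) ^ 2 := by
      simp only [F, Finset.card_product, Int.card_Icc]
      push_cast
      rw [Int.toNat_of_nonneg (by linarith)]
      ring
    exact_mod_cast this
  have h1 : (E.ncard : ℝ) ≤ (2 * n + 1) ^ 2 := by rw [← hF]; exact_mod_cast hcard
  have hn0' : (0 : ℝ) ≤ n := by exact_mod_cast hn0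
  have h2 : δ * (2 * n + 1) ≤ 4 := by
    have : δ * n ≤ δ * (1 / 5 / δ + 1) := by gcongr
    have e : δ * (1 / 5 / δ + 1) = 1 / 5 + δ := by field_simp
    nlinarith
  calc δ ^ 2 * E.ncard ≤ δ ^ 2 * (2 * n + 1) ^ 2 := by gcongr
    _ = (δ * (2 * n + 1)) ^ 2 := by ring
    _ ≤ 4 ^ 2 := by gcongr
    _ = 16 := by norm_num

lemma exists_injOn_fibers {α β : Type*} {S : Set α} (hS : S.Finite) (g : α → β) {N : ℕ}
    (hN : ∀ b, {a ∈ S | g a = b}.ncard ≤ N) :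
    ∃ k : α → ℕ, (∀ a ∈ S, k a < N) ∧ ∀ a ∈ S, ∀ b ∈ S, g a = g b → k a = k b → a = b := by
  classical
  have key : ∀ b, ∃ k : α → ℕ, (∀ a ∈ S, g a = b → k a < N) ∧
      Set.InjOn k {a ∈ S | g a = b} := by
    intro b
    have hf : {a ∈ S | g a = b}.Finite := hS.subset (Set.sep_subset _ _)
    obtain ⟨k, hk, hinj⟩ := Set.Finite.exists_injOn_of_encard_le (s := {a ∈ S | g a = b})
      (t := ((Finset.range N : Finset ℕ) : Set ℕ)) hf (by
        rw [← hf.cast_ncard_eq, Set.encard_coe_eq_coe_finsetCard, Finset.card_range]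
        exact_mod_cast hN b)
    exact ⟨k, fun a ha hb ↦ by simpa using hk (show a ∈ {a ∈ S | g a = b} from ⟨ha, hb⟩), hinj⟩
  choose k hk hinj using key
  refine ⟨fun a ↦ k (g a) a, fun a ha ↦ hk _ a ha rfl, fun a ha b hb hg he ↦ ?_⟩
  refine hinj (g a) ⟨ha, rfl⟩ ⟨hb, hg.symm⟩ ?_
  simpa [hg] using he

/-- A collection of tubes of directional multiplicity at most `m` splits into at most `M² m`
subcollections with well-separated directions. -/
lemma exists_separated_coloring {σ m : ℝ} (hσ : 0 < σ) {𝕋 : Set Tube} (h𝕋 : 𝕋.Finite)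
    (hm : DirMultLE σ 𝕋 m) (M : ℕ) [NeZero M] :
    ∃ (s : Finset (ZMod M × ZMod M × ℕ)) (col : Tube → ZMod M × ZMod M × ℕ),
      (s.card : ℝ) ≤ M ^ 2 * m ∧ (∀ T ∈ 𝕋, col T ∈ s) ∧
        ∀ T ∈ 𝕋, ∀ T' ∈ 𝕋, T ≠ T' → col T = col T' → (M - 1) * (σ / 2) < dist T.dir T'.dir := by
  have hm0 : 0 ≤ m := (Nat.cast_nonneg _).trans (hm 0)
  set g : Tube → ℤ × ℤ := fun T ↦ (⌊T.dir 0 / (σ / 2)⌋, ⌊T.dir 1 / (σ / 2)⌋)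
  obtain ⟨k, hk, hinj⟩ := exists_injOn_fibers h𝕋 g (N := ⌊m⌋₊) (by
    intro b
    refine Nat.le_floor ?_
    rcases Set.eq_empty_or_nonempty {T ∈ 𝕋 | g T = b} with h | ⟨T₀, -, h₀⟩
    · simpa [h] using hm0
    · refine le_trans ?_ (hm T₀.dir)
      norm_cast
      refine Set.ncard_le_ncard ?_ (h𝕋.subset (Set.sep_subset _ _))
      rintro T ⟨hT, hTb⟩
      rw [← h₀] at hTb
      simp only [g, Prod.mk.injEq] at hTb
      exact ⟨hT, (T.isDirection_dir.dist_lt_of_floor_eq T₀.isDirection_dir hσ hTb.1 hTb.2).le⟩)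
  refine ⟨Finset.univ ×ˢ Finset.univ ×ˢ Finset.range ⌊m⌋₊,
    fun T ↦ ((g T).1, (g T).2, k T), ?_, ?_, ?_⟩
  · simp only [Finset.card_product, Finset.card_univ, ZMod.card, Finset.card_range]
    push_cast
    calc (M : ℝ) * (M * ⌊m⌋₊) = M ^ 2 * ⌊m⌋₊ := by ring
      _ ≤ M ^ 2 * m := by gcongr; exact Nat.floor_le hm0
  · intro T hT
    simpa using hk T hT
  · intro T hT T' hT' hne hcol
    simp only [Prod.mk.injEq] at hcol
    obtain ⟨h0, h1, h2⟩ := hcol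
    rw [dist_eq_norm]
    have hg : g T ≠ g T' := fun h ↦ hne (hinj T hT T' hT' h h2)
    rcases not_and_or.1 (mt Prod.ext_iff.2 hg) with h | h
    · exact (lt_abs_sub_of_floor_ne (half_pos hσ) h0 h).trans_le
        (abs_apply_le_norm (T.dir - T'.dir) 0)
    · exact (lt_abs_sub_of_floor_ne (half_pos hσ) h1 h).trans_le
        (abs_apply_le_norm (T.dir - T'.dir) (1 : Fin 3))

/-- Equivalent tubes have nearly parallel cores. -/
lemma TubeEquiv.dist_dir_le {C δ : ℝ} (hδ : 0 < δ) {T T' : Tube}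
    (h : TubeEquiv C δ T T') : dist T.dir T'.dir ≤ 6 * (C * δ) := by
  have h0 : T.p0 ∈ T'.set (C * δ) := h.1 ((T.mem_set_iff δ _).2 ⟨0, by simp, by simpa using hδ⟩)
  have h1 : T.p1 ∈ T'.set (C * δ) :=
    h.1 ((T.mem_set_iff δ _).2 ⟨1, by simp, by simpa [Tube.dir] using hδ⟩)
  obtain ⟨t, ht, hd⟩ := (T'.mem_set_iff _ _).1 h0
  obtain ⟨u, hu, hd'⟩ := (T'.mem_set_iff _ _).1 h1
  rw [dist_eq_norm] at hd hd' ⊢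
  have d2 := T'.isDirection_dir.1
  have ht' := (abs_apply_le_norm _ 2).trans hd.le
  have hu' := (abs_apply_le_norm _ 2).trans hd'.le
  simp only [PiLp.sub_apply, PiLp.add_apply, PiLp.smul_apply, T.h0, T.h1, T'.h0, d2, smul_eq_mul,
    mul_one, zero_add, zero_sub] at ht' hu'
  have e : T.dir - T'.dir = (T.p1 - (T'.p0 + u • T'.dir)) - (T.p0 - (T'.p0 + t • T'.dir))
      + (u - 1 - t) • T'.dir := by
    rw [Tube.dir]; module
  have h3 : |u - 1 - t| ≤ 2 * (C * δ) := by
    rw [abs_le] at *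
    constructor <;> linarith
  have h4 : ‖(u - 1 - t) • T'.dir‖ ≤ 2 * (C * δ) * 2 := by
    rw [norm_smul, Real.norm_eq_abs]
    exact mul_le_mul h3 T'.isDirection_dir.norm_le (norm_nonneg _) ((abs_nonneg _).trans h3)
  rw [e]
  calc _ ≤ ‖T.p1 - (T'.p0 + u • T'.dir)‖ + ‖T.p0 - (T'.p0 + t • T'.dir)‖ +
        ‖(u - 1 - t) • T'.dir‖ := (norm_add_le _ _).trans (by gcongr; exact norm_sub_le _ _)
    _ ≤ _ := by linarith

/-- The matrix of the map sending the direction `(a, b, 1)` to the vertical and dilating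
horizontal planes by `1 / s`. -/
def shearMatrix (a b s : ℝ) : Matrix (Fin 3) (Fin 3) ℝ :=
  !![1 / s, 0, -a / s; 0, 1 / s, -b / s; 0, 0, 1]

/-- The linear map of `shearMatrix`. -/
def shear (a b s : ℝ) : R3 →ₗ[ℝ] R3 := Matrix.toLpLin 2 2 (shearMatrix a b s)

lemma shear_apply_zero (a b s : ℝ) (x : R3) : shear a b s x 0 = (x 0 - a * x 2) / s := by
  simp [shear, shearMatrix, Matrix.toLpLin_apply, dotProduct, Fin.sum_univ_three]
  ring

lemma shear_apply_one (a b s : ℝ) (x : R3) : shear a b s x 1 = (x 1 - b * x 2) / s := by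
  simp [shear, shearMatrix, Matrix.toLpLin_apply, dotProduct, Fin.sum_univ_three]
  ring

lemma shear_apply_two (a b s : ℝ) (x : R3) : shear a b s x 2 = x 2 := by
  simp [shear, shearMatrix, Matrix.toLpLin_apply, dotProduct, Fin.sum_univ_three]

lemma det_shear (a b s : ℝ) : LinearMap.det (shear a b s) = 1 / s ^ 2 := by
  rw [shear, Matrix.toLpLin_eq_toLin, LinearMap.det_toLin, Matrix.det_fin_three]
  simp [shearMatrix]
  ring

lemma norm_shear_le {a b s : ℝ} (ha : |a| ≤ 1 / 10) (hb : |b| ≤ 1 / 10) (hs : 0 < s) (hs1 : s ≤ 1)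
    (x : R3) : ‖shear a b s x‖ ≤ 2 / s * ‖x‖ := by
  refine norm_le_of_sq_le (by positivity) ?_
  rw [shear_apply_zero, shear_apply_one, shear_apply_two, mul_pow, sq_norm_R3]
  have hx2 : x 2 ^ 2 ≤ (x 2 / s) ^ 2 := by
    rw [div_pow, le_div_iff₀ (by positivity)]
    nlinarith [sq_nonneg (x 2), mul_le_one₀ hs1 hs.le hs1]
  have ha2 := sq_le_sq' (abs_le.1 ha).1 (abs_le.1 ha).2
  have hb2 := sq_le_sq' (abs_le.1 hb).1 (abs_le.1 hb).2
  have key : ∀ u c : ℝ, c ^ 2 ≤ (1 / 10) ^ 2 → (u - c * x 2) ^ 2 ≤ 2 * u ^ 2 + x 2 ^ 2 := by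
    intro u c hc
    nlinarith [sq_nonneg (u + c * x 2), mul_le_mul_of_nonneg_right hc (sq_nonneg (x 2)),
      sq_nonneg (x 2)]
  have k0 := key (x 0) a ha2
  have k1 := key (x 1) b hb2
  calc ((x 0 - a * x 2) / s) ^ 2 + ((x 1 - b * x 2) / s) ^ 2 + x 2 ^ 2
      ≤ ((x 0 - a * x 2) / s) ^ 2 + ((x 1 - b * x 2) / s) ^ 2 + (x 2 / s) ^ 2 := by gcongr
    _ = ((x 0 - a * x 2) ^ 2 + (x 1 - b * x 2) ^ 2 + x 2 ^ 2) / s ^ 2 := by ring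
    _ ≤ (4 * (x 0 ^ 2 + x 1 ^ 2 + x 2 ^ 2)) / s ^ 2 := by
      gcongr
      nlinarith [sq_nonneg (x 0), sq_nonneg (x 1), sq_nonneg (x 2)]
    _ = (2 / s) ^ 2 * (x 0 ^ 2 + x 1 ^ 2 + x 2 ^ 2) := by ring

lemma lintegral_comp_shear (a b : ℝ) {s : ℝ} (hs : 0 < s) {g : R3 → ℝ≥0∞} (hg : Measurable g) :
    ∫⁻ x, g (shear a b s x) = ENNReal.ofReal (s ^ 2) * ∫⁻ x, g x := by
  have hdet : LinearMap.det (shear a b s) ≠ 0 := by rw [det_shear]; positivity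
  have hc : Measurable (shear a b s) :=
    (LinearMap.continuous_of_finiteDimensional (shear a b s)).measurable
  rw [← lintegral_map hg hc, Measure.map_linearMap_addHaar_eq_smul_addHaar _ hdet,
    lintegral_smul_measure, det_shear, one_div, inv_inv, abs_of_nonneg (by positivity), smul_eq_mul]

lemma exists_shear_tube {a b s : ℝ} (T : Tube) (h0 : |(T.dir 0 - a) / s| ≤ 1 / 10)
    (h1 : |(T.dir 1 - b) / s| ≤ 1 / 10) :
    ∃ T' : Tube, T'.p0 = shear a b s T.p0 ∧ T'.dir = shear a b s T.dir := by
  have h2 := T.isDirection_dir.1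
  refine ⟨⟨shear a b s T.p0, shear a b s T.p1, ?_, ?_, ?_, ?_⟩, rfl, ?_⟩
  · rw [shear_apply_two, T.h0]
  · rw [shear_apply_two, T.h1]
  · rw [← map_sub, ← Tube.dir, shear_apply_zero, h2, mul_one]; exact h0
  · rw [← map_sub, ← Tube.dir, shear_apply_one, h2, mul_one]; exact h1
  · simp [Tube.dir, map_sub]

lemma shear_mem_tube_set {a b s σ : ℝ} (ha : |a| ≤ 1 / 10) (hb : |b| ≤ 1 / 10) (hs : 0 < s)
    (hs1 : s ≤ 1) {T T' : Tube} (h0 : T'.p0 = shear a b s T.p0)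
    (hd : T'.dir = shear a b s T.dir) {x : R3} (hx : x ∈ T.set σ) :
    shear a b s x ∈ T'.set (2 / s * σ) := by
  obtain ⟨t, ht, hlt⟩ := (T.mem_set_iff _ _).1 hx
  refine (T'.mem_set_iff _ _).2 ⟨t, ht, ?_⟩
  rw [h0, hd, ← map_smul, ← map_add, dist_eq_norm, ← map_sub]
  refine (norm_shear_le ha hb hs hs1 _).trans_lt ?_
  rw [← dist_eq_norm]
  gcongr

lemma dist_shear_of_isDirection (a b : ℝ) {s : ℝ} (hs : 0 < s) {v w : R3} (hv : IsDirection v)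
    (hw : IsDirection w) : dist (shear a b s v) (shear a b s w) = dist v w / s := by
  have h : shear a b s v - shear a b s w = (1 / s) • (v - w) := by
    ext i
    fin_cases i
    · simp [shear_apply_zero, hv.1, hw.1]; ring
    · simp [shear_apply_one, hv.1, hw.1]; ring
    · simp [shear_apply_two, hv.1, hw.1]
  rw [dist_eq_norm, h, norm_smul, Real.norm_of_nonneg (by positivity), dist_eq_norm]
  ring

/-- The Kakeya estimate for tubes with pairwise well-separated directions, for which essential
distinctness is automatic. -/
lemma KakeyaEstimate.tubeNorm_le_of_separated {C d α A₀ : ℝ} (hK : KakeyaEstimate C d α A₀)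
    (hC : 1 ≤ C) (hα : 0 < α) (hA₀ : 0 < A₀) {δ : ℝ} (hδ : 0 < δ) (hδ1 : δ < 1) {𝕋 : Set Tube}
    (h𝕋 : 𝕋.Finite) (hsep : ∀ T ∈ 𝕋, ∀ T' ∈ 𝕋, T ≠ T' → 6 * (C * δ) < dist T.dir T'.dir) :
    tubeNorm δ (d / (d - 1)) 𝕋 ≤ ENNReal.ofReal (A₀ * δ ^ (1 - 3 / d) * 16 ^ α) := by
  have hCδ : δ ≤ C * δ := le_mul_of_one_le_left hδ.le hC
  have hdir : ∀ v ∈ Tube.dir '' 𝕋, IsDirection v := by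
    rintro _ ⟨T, -, rfl⟩
    exact T.isDirection_dir
  have hE : Separated δ (Tube.dir '' 𝕋) := by
    rintro _ ⟨T, hT, rfl⟩ _ ⟨T', hT', rfl⟩ hne
    linarith [hsep T hT T' hT' (fun h ↦ hne (h ▸ rfl))]
  refine (hK δ hδ hδ1 _ hdir hE (h𝕋.image _) 𝕋 ⟨h𝕋, fun T hT ↦ ?_⟩
    (fun T hT ↦ Set.mem_image_of_mem _ hT) 1 fun ω ↦ ?_).trans ?_
  · have : {T' ∈ 𝕋 | T' ≠ T ∧ TubeEquiv C δ T T'} = ∅ := by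
      refine Set.eq_empty_of_forall_notMem ?_
      rintro T' ⟨hT', hne, he⟩
      exact absurd (he.dist_dir_le hδ) (not_le.2 (hsep T hT T' hT' hne.symm))
    rw [this]
    simp; linarith
  · have : {T ∈ 𝕋 | dist T.dir ω ≤ δ}.ncard ≤ 1 := by
      refine (Set.ncard_le_one (h𝕋.subset (Set.sep_subset _ _))).2 ?_
      rintro T ⟨hT, h⟩ T' ⟨hT', h'⟩
      by_contra hne
      linarith [hsep T hT T' hT' hne, dist_triangle_right T.dir T'.dir ω]
    exact_mod_cast this
  · refine ENNReal.ofReal_le_ofReal ?_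
    rw [mul_one]
    gcongr
    exact hE.sq_mul_ncard_le hδ hδ1 hdir

lemma KakeyaEstimate.tubeNorm_le_of_separated_of_cap {C d α A₀ : ℝ} (hK : KakeyaEstimate C d α A₀)
    (hC : 1 ≤ C) (hd : 1 < d) (hα : 0 < α) (hA₀ : 0 < A₀) {σ θ : ℝ} (hσ : 0 < σ) (hσθ : σ ≤ θ)
    (hθ : θ ≤ 1 / 20) {𝕋 : Set Tube} (h𝕋 : 𝕋.Finite)
    (hsep : ∀ T ∈ 𝕋, ∀ T' ∈ 𝕋, T ≠ T' → 12 * (C * σ) < dist T.dir T'.dir) {ω : R3}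
    (hω : ∀ T ∈ 𝕋, dist T.dir ω ≤ θ) :
    tubeNorm σ (d / (d - 1)) 𝕋 ≤ ENNReal.ofReal
      (((20 * θ) ^ 2) ^ ((d - 1) / d) * (A₀ * (σ / (10 * θ)) ^ (1 - 3 / d) * 16 ^ α)) := by
  have hp : 0 < d / (d - 1) := div_pos (by linarith) (by linarith)
  rcases Set.eq_empty_or_nonempty 𝕋 with rfl | ⟨T₀, hT₀⟩
  · rw [tubeNorm_empty _ hp]; exact zero_le
  have hθ0 : 0 < θ := hσ.trans_le hσθ
  set s : ℝ := 20 * θ with hs_def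
  have hs : 0 < s := by positivity
  have hs1 : s ≤ 1 := by linarith
  have hδ_eq : 2 / s * σ = σ / (10 * θ) := by rw [hs_def]; field_simp; norm_num
  set a := T₀.dir 0
  set b := T₀.dir 1
  have ha : |a| ≤ 1 / 10 := T₀.hx
  have hb : |b| ≤ 1 / 10 := T₀.hy
  have hcap : ∀ T ∈ 𝕋, ‖T.dir - T₀.dir‖ ≤ 2 * θ := fun T hT ↦ by
    rw [← dist_eq_norm]
    linarith [dist_triangle_right T.dir T₀.dir ω, hω T hT, hω T₀ hT₀]
  have hcap' : ∀ T ∈ 𝕋, ∀ i, |(T.dir i - T₀.dir i) / s| ≤ 1 / 10 := fun T hT i ↦ by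
    rw [abs_div, abs_of_pos hs, div_le_iff₀ hs]
    have := (abs_apply_le_norm (T.dir - T₀.dir) i).trans (hcap T hT)
    rw [PiLp.sub_apply] at this
    linarith
  have : Nonempty Tube := ⟨T₀⟩
  have hex : ∀ T ∈ 𝕋, ∃ T' : Tube, T'.p0 = shear a b s T.p0 ∧ T'.dir = shear a b s T.dir :=
    fun T hT ↦ exists_shear_tube T (hcap' T hT 0) (hcap' T hT 1)
  choose! F hF0 hFd using hex
  have hsep' : ∀ T ∈ 𝕋, ∀ T' ∈ 𝕋, T ≠ T' →
      6 * (C * (σ / (10 * θ))) < dist (F T).dir (F T').dir := fun T hT T' hT' hne ↦ by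
    rw [hFd T hT, hFd T' hT', dist_shear_of_isDirection a b hs T.isDirection_dir T'.isDirection_dir,
      ← hδ_eq, lt_div_iff₀ hs]
    have e : 6 * (C * (2 / s * σ)) * s = 12 * (C * σ) := by field_simp; ring
    rw [e]
    exact hsep T hT T' hT' hne
  have hδ : 0 < σ / (10 * θ) := by positivity
  have hFinj : Set.InjOn F 𝕋 := fun T hT T' hT' h ↦ by
    by_contra hne
    have := hsep' T hT T' hT' hne
    rw [h, dist_self] at this
    have : 0 < 6 * (C * (σ / (10 * θ))) := by positivity
    linarith
  have hF𝕋 : (F '' 𝕋).Finite := h𝕋.image F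
  have hKak := hK.tubeNorm_le_of_separated hC hα hA₀ hδ
    (by rw [div_lt_one (by positivity)]; linarith) hF𝕋 (by
      rintro _ ⟨T, hT, rfl⟩ _ ⟨T', hT', rfl⟩ hne
      exact hsep' T hT T' hT' fun h ↦ hne (h ▸ rfl))
  have hcount : ∀ x, tubeCount σ 𝕋 x ≤ tubeCount (σ / (10 * θ)) (F '' 𝕋) (shear a b s x) := by
    intro x
    rw [tubeCount, tubeCount]
    norm_cast
    refine Set.ncard_le_ncard_of_injOn F ?_ (hFinj.mono (Set.sep_subset _ _))
      (hF𝕋.subset (Set.sep_subset _ _))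
    rintro T ⟨hT, hx⟩
    refine ⟨Set.mem_image_of_mem _ hT, ?_⟩
    rw [← hδ_eq]
    exact shear_mem_tube_set ha hb hs hs1 (hF0 T hT) (hFd T hT) hx
  have hint : ∫⁻ x : R3, ENNReal.ofReal (tubeCount σ 𝕋 x ^ (d / (d - 1))) ≤
      ENNReal.ofReal (s ^ 2) *
        ∫⁻ x : R3, ENNReal.ofReal (tubeCount (σ / (10 * θ)) (F '' 𝕋) x ^ (d / (d - 1))) := by
    rw [← lintegral_comp_shear a b hs
      (((measurable_tubeCount _ hF𝕋).pow_const (d / (d - 1))).ennreal_ofReal)]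
    exact lintegral_mono fun x ↦ ENNReal.ofReal_le_ofReal
      (Real.rpow_le_rpow (tubeCount_nonneg _ _ _) (hcount x) hp.le)
  have hp' : 0 ≤ 1 / (d / (d - 1)) := by positivity
  refine (ENNReal.rpow_le_rpow hint hp').trans ?_
  rw [ENNReal.mul_rpow_of_nonneg _ _ hp', ENNReal.ofReal_rpow_of_nonneg (by positivity) hp',
    one_div_div, ENNReal.ofReal_mul (by positivity)]
  gcongr
  rw [tubeNorm, one_div_div] at hKak
  exact hKak

lemma rescaled_bound_eq {d : ℝ} (hd : 0 < d) (α A₀ : ℝ) {σ θ : ℝ} (hσ : 0 < σ) (hθ : 0 < θ) :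
    ((20 * θ) ^ 2) ^ ((d - 1) / d) * (A₀ * (σ / (10 * θ)) ^ (1 - 3 / d) * 16 ^ α) =
      (400 ^ ((d - 1) / d) * A₀ * 10 ^ ((3 - d) / d) * 16 ^ α) *
        (σ ^ ((d - 3) / d) * θ ^ ((d + 1) / d)) := by
  have e1 : 1 - 3 / d = (d - 3) / d := by field_simp
  have e2 : (d + 1) / d = 2 * ((d - 1) / d) + (3 - d) / d := by field_simp; ring
  have e3 : (d - 3) / d = -((3 - d) / d) := by ring
  rw [e1, mul_pow, Real.mul_rpow (by positivity) (by positivity),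
    Real.div_rpow hσ.le (by positivity), Real.mul_rpow (by positivity) hθ.le, e2,
    Real.rpow_add hθ, Real.rpow_mul hθ.le, e3, Real.rpow_neg (by positivity : (0 : ℝ) ≤ 10),
    Real.rpow_neg hθ.le, Real.rpow_two]
  norm_num
  field_simp

end TubeLemmas

/-- Rescaled Kakeya estimate (Lemma 2.4, first part): if a Kakeya estimate holds at
dimension d ∈ (2,3) with exponent α and constant A₀, then there is a constant A such
that for all δ ≤ σ ≤ θ ≤ c₀ and every collection 𝕋 of essentially distinct σ-tubes,
with directional multiplicity at most m₀ at scale σ, whose directions lie in a cap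
of radius θ, one has ‖∑ χ_T‖_{d'} ≤ A m₀ σ^{(d-3)/d} θ^{(d+1)/d}. -/
theorem kakeya_rescaled (Ceq d α A₀ : ℝ) (hCeq : 1 ≤ Ceq) (hd2 : 2 < d) (hd3 : d < 3)
    (hα : 0 < α) (hα1 : α < 1) (hA₀ : 0 < A₀)
    (hK : KakeyaEstimate Ceq d α A₀) :
    ∃ A c₀ : ℝ, 0 < A ∧ 0 < c₀ ∧
      ∀ δ σ θ : ℝ, 0 < δ → δ ≤ σ → σ ≤ θ → θ ≤ c₀ →
        ∀ 𝕋 : Set Tube, EssDistinct Ceq σ 𝕋 →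
          ∀ m₀ : ℝ, DirMultLE σ 𝕋 m₀ →
            (∃ ω : R3, ∀ T ∈ 𝕋, dist T.dir ω ≤ θ) →
            tubeNorm σ (d / (d - 1)) 𝕋 ≤
              ENNReal.ofReal (A * m₀ * σ ^ ((d - 3) / d) * θ ^ ((d + 1) / d)) := by
  set M : ℕ := ⌈24 * Ceq⌉₊ + 1 with hM_def
  set K : ℝ := 400 ^ ((d - 1) / d) * A₀ * 10 ^ ((3 - d) / d) * 16 ^ α with hK_def
  have hK0 : 0 < K := by positivity
  refine ⟨M ^ 2 * K, 1 / 20, by positivity, by norm_num, ?_⟩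
  rintro δ σ θ hδ hδσ hσθ hθ 𝕋 ⟨h𝕋, -⟩ m₀ hm ⟨ω, hω⟩
  have hσ : 0 < σ := hδ.trans_le hδσ
  have hθ0 : 0 < θ := hσ.trans_le hσθ
  have hp : 1 ≤ d / (d - 1) := by rw [one_le_div (by linarith)]; linarith
  obtain ⟨s, col, hs, hcol, hsep⟩ := exists_separated_coloring hσ h𝕋 hm M
  have hM : 12 * (Ceq * σ) ≤ (M - 1) * (σ / 2) := by
    have : 24 * Ceq ≤ ⌈24 * Ceq⌉₊ := Nat.le_ceil _
    rw [hM_def]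
    push_cast
    nlinarith
  refine (tubeNorm_le_card_mul σ hp h𝕋 s col hcol fun c _ ↦
    hK.tubeNorm_le_of_separated_of_cap hCeq (by linarith) hα hA₀ hσ hσθ hθ
      (h𝕋.subset (Set.sep_subset _ _))
      (fun T hT T' hT' hne ↦
        hM.trans_lt (hsep T hT.1 T' hT'.1 hne (hT.2.trans hT'.2.symm)))
      fun T hT ↦ hω T hT.1).trans ?_
  rw [rescaled_bound_eq (by linarith) α A₀ hσ hθ0, ← hK_def, ← ENNReal.ofReal_natCast,
    ← ENNReal.ofReal_mul (Nat.cast_nonneg _)]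
  refine ENNReal.ofReal_le_ofReal ?_
  calc (s.card : ℝ) * (K * (σ ^ ((d - 3) / d) * θ ^ ((d + 1) / d)))
      ≤ M ^ 2 * m₀ * (K * (σ ^ ((d - 3) / d) * θ ^ ((d + 1) / d))) := by gcongr
    _ = _ := by ring

end
end

section
/- Let (X, μ) be a measure space and f : X → [0,∞] a measurable function. Suppose that for some A, B > 0 and 0 < λ ≤ 1 one has μ(supp f) ≤ A, f ≤ B μ-almost everywhere, and ∫ f dμ ≥ λ A B. Then the set E = {x ∈ X : f(x) > λB/2} is nonempty and satisfies: E ⊆ supp f (so μ(E) ≤ A), μ(E) ≥ (λ/2) A, f > λB/2 on E, and ∫_E f dμ ≥ (λ/2) A B. -/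
open MeasureTheory
open scoped ENNReal

/-- The superlevel set `{c < f}` carries all of the integral of `f` except for at most `c` times the
measure of the support. -/
theorem lintegral_le_setLIntegral_superlevel_add {X : Type*} [MeasurableSpace X] (μ : Measure X)
    {f : X → ℝ≥0∞} (hf : Measurable f) (c : ℝ≥0∞) :
    ∫⁻ x, f x ∂μ ≤ ∫⁻ x in {x | c < f x}, f x ∂μ + c * μ (Function.support f) := by
  have hE : MeasurableSet {x | c < f x} := measurableSet_lt measurable_const hf
  have hS : MeasurableSet (Function.support f) := measurableSet_support hf
  rw [← lintegral_indicator hE, ← lintegral_indicator_const hS,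
    ← lintegral_add_left (hf.indicator hE)]
  refine lintegral_mono fun x ↦ ?_
  by_cases hx : c < f x
  · simp [Set.indicator, hx]
  · by_cases h0 : f x = 0
    · simp [h0]
    · simp [Set.indicator, hx, h0, not_lt.1 hx]

/-- The uniformity lemma (Lemma 1.2): if f is supported on a set of measure at most A,
bounded a.e. by B, and has integral at least λAB, then the set E = {f > λB/2} is
nonempty, contained in the support, has measure between (λ/2)A and A, f exceeds λB/2
on E, and the integral of f over E is at least (λ/2)AB. -/
theorem uniformity_lemma {X : Type*} [MeasurableSpace X] (μ : Measure X)
    (f : X → ℝ≥0∞) (hf : Measurable f) (A B lam : ℝ)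
    (hA : 0 < A) (hB : 0 < B) (hlam : 0 < lam) (hlam1 : lam ≤ 1)
    (hsupp : μ (Function.support f) ≤ ENNReal.ofReal A)
    (hbdd : ∀ᵐ x ∂μ, f x ≤ ENNReal.ofReal B)
    (hint : ENNReal.ofReal (lam * A * B) ≤ ∫⁻ x, f x ∂μ) :
    {x | ENNReal.ofReal (lam * B / 2) < f x}.Nonempty ∧
      {x | ENNReal.ofReal (lam * B / 2) < f x} ⊆ Function.support f ∧
      μ {x | ENNReal.ofReal (lam * B / 2) < f x} ≤ ENNReal.ofReal A ∧
      ENNReal.ofReal (lam / 2 * A) ≤ μ {x | ENNReal.ofReal (lam * B / 2) < f x} ∧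
      (∀ x ∈ {x | ENNReal.ofReal (lam * B / 2) < f x}, ENNReal.ofReal (lam * B / 2) < f x) ∧
      ENNReal.ofReal (lam / 2 * A * B) ≤
        ∫⁻ x in {x | ENNReal.ofReal (lam * B / 2) < f x}, f x ∂μ := by
  set E := {x | ENNReal.ofReal (lam * B / 2) < f x}
  have hsub : E ⊆ Function.support f := fun x hx ↦ (bot_le.trans_lt hx).ne'
  have hintE : ENNReal.ofReal (lam / 2 * A * B) ≤ ∫⁻ x in E, f x ∂μ := by
    have h : ENNReal.ofReal (lam / 2 * A * B) + ENNReal.ofReal (lam / 2 * A * B) ≤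
        ∫⁻ x in E, f x ∂μ + ENNReal.ofReal (lam / 2 * A * B) :=
      calc ENNReal.ofReal (lam / 2 * A * B) + ENNReal.ofReal (lam / 2 * A * B)
          = ENNReal.ofReal (lam * A * B) := by
            rw [← ENNReal.ofReal_add (by positivity) (by positivity)]
            ring_nf
        _ ≤ ∫⁻ x, f x ∂μ := hint
        _ ≤ ∫⁻ x in E, f x ∂μ + ENNReal.ofReal (lam * B / 2) * μ (Function.support f) :=
            lintegral_le_setLIntegral_superlevel_add μ hf _
        _ ≤ ∫⁻ x in E, f x ∂μ + ENNReal.ofReal (lam * B / 2) * ENNReal.ofReal A := by gcongr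
        _ = ∫⁻ x in E, f x ∂μ + ENNReal.ofReal (lam / 2 * A * B) := by
            rw [← ENNReal.ofReal_mul (by positivity)]
            ring_nf
    exact (ENNReal.add_le_add_iff_right ENNReal.ofReal_ne_top).1 h
  have hmeasE : ENNReal.ofReal (lam / 2 * A) ≤ μ E := by
    have h : ENNReal.ofReal (lam / 2 * A) * ENNReal.ofReal B ≤ μ E * ENNReal.ofReal B :=
      calc ENNReal.ofReal (lam / 2 * A) * ENNReal.ofReal B
          = ENNReal.ofReal (lam / 2 * A * B) := (ENNReal.ofReal_mul (by positivity)).symm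
        _ ≤ ∫⁻ x in E, f x ∂μ := hintE
        _ ≤ ∫⁻ _ in E, ENNReal.ofReal B ∂μ := lintegral_mono_ae (ae_restrict_of_ae hbdd)
        _ = μ E * ENNReal.ofReal B := by rw [setLIntegral_const, mul_comm]
    exact (ENNReal.mul_le_mul_iff_left (ENNReal.ofReal_pos.2 hB).ne' ENNReal.ofReal_ne_top).1 h
  have hpos : 0 < μ E := (ENNReal.ofReal_pos.2 (by positivity)).trans_le hmeasE
  exact ⟨nonempty_of_measure_ne_zero hpos.ne', hsub, (measure_mono hsub).trans hsupp, hmeasE,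
    fun _ hx ↦ hx, hintE⟩
end
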